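/- Let 𝒮, 𝒴, 𝒰 be finite types with 𝒰 nonempty, let Δ(𝒮) denote the standard probability simplex in ℝ^𝒮, let γ ∈ ℝ with 0 ≤ γ, and for each u ∈ 𝒰: let ρ̄(·, u) : ℝ^𝒮 → ℝ be concave on Δ(𝒮); let M(u, y) ∈ ℝ^{𝒮×𝒮} for y ∈ 𝒴 be matrices with nonnegative entries such that σ(ξ, u, y) := Σ_{s′,s} M(u, y)_{s′,s} · ξ(s) > 0 for every ξ ∈ Δ(𝒮) and y ∈ 𝒴, and Σ_{y} Σ_{s′} M(u, y)_{s′,s} = 1 for every s; and define T(ξ, u, y) ∈ Δ(𝒮) by T(ξ, u, y)(s′) = (Σ_s M(u, y)_{s′,s} ξ(s)) / σ(ξ, u, y). Then for every function V : ℝ^𝒮 → ℝ that is concave on Δ(𝒮), the Bellman update ξ ↦ min over u ∈ 𝒰 of [ ρ̄(ξ, u) + γ · Σ_{y ∈ 𝒴} σ(ξ, u, y) · V(T(ξ, u, y)) ] is concave on Δ(𝒮). -/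

import Mathlib

/-- The degree-one homogeneous extension of a concave function on the standard simplex is
concave on the nonzero part of the nonnegative orthant. -/
theorem ConcaveOn.sum_mul_comp_div_sum {ι : Type*} [Fintype ι] {V : (ι → ℝ) → ℝ}
    (hV : ConcaveOn ℝ (stdSimplex ℝ ι) V) :
    ConcaveOn ℝ {x : ι → ℝ | (∀ i, 0 ≤ x i) ∧ 0 < ∑ i, x i}
      (fun x => (∑ i, x i) * V (fun i => x i / ∑ j, x j)) := by
  have hnorm : ∀ x : ι → ℝ, (∀ i, 0 ≤ x i) → 0 < ∑ i, x i →
      (fun i => x i / ∑ j, x j) ∈ stdSimplex ℝ ι := fun x hx hs =>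
    ⟨fun i => div_nonneg (hx i) hs.le, by rw [← Finset.sum_div, div_self hs.ne']⟩
  have hcomb : ∀ (x y : ι → ℝ) (a b : ℝ),
      ∑ i, (a • x + b • y) i = a * ∑ i, x i + b * ∑ i, y i := fun x y a b => by
    simp [Finset.sum_add_distrib, Finset.mul_sum]
  have hpos : ∀ {S T a b : ℝ}, 0 < S → 0 < T → 0 ≤ a → 0 ≤ b → a + b = 1 →
      0 < a * S + b * T := fun {S T a b} hS hT ha hb hab =>
    (convex_Ioi (0 : ℝ)) hS hT ha hb hab
  refine ⟨?_, ?_⟩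
  · rintro x ⟨hx, hxs⟩ y ⟨hy, hys⟩ a b ha hb hab
    refine ⟨fun i => add_nonneg (mul_nonneg ha (hx i)) (mul_nonneg hb (hy i)), ?_⟩
    rw [hcomb]
    exact hpos hxs hys ha hb hab
  · rintro x ⟨hx, hxs⟩ y ⟨hy, hys⟩ a b ha hb hab
    have hR := hpos hxs hys ha hb hab
    have hx' := hnorm x hx hxs
    have hy' := hnorm y hy hys
    simp only [hcomb]
    set S := ∑ i, x i
    set T := ∑ i, y i
    have key := hV.2 hx' hy' (div_nonneg (mul_nonneg ha hxs.le) hR.le)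
      (div_nonneg (mul_nonneg hb hys.le) hR.le) (by rw [← add_div, div_self hR.ne'])
    have hpt : (a * S / (a * S + b * T)) • (fun i => x i / S) +
        (b * T / (a * S + b * T)) • (fun i => y i / T) =
        fun i => (a • x + b • y) i / (a * S + b * T) := by
      funext i
      simp only [Pi.add_apply, Pi.smul_apply, smul_eq_mul]
      field_simp
    rw [hpt] at key
    refine le_trans (le_of_eq ?_) (mul_le_mul_of_nonneg_left key hR.le)
    simp only [smul_eq_mul]
    field_simp

theorem ConcaveOn.fun_sum {E ι : Type*} [AddCommGroup E] [Module ℝ E] {s : Set E}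
    (hs : Convex ℝ s) (t : Finset ι) {f : ι → E → ℝ} (hf : ∀ i ∈ t, ConcaveOn ℝ s (f i)) :
    ConcaveOn ℝ s (fun x => ∑ i ∈ t, f i x) := by
  refine ⟨hs, fun x hx y hy a b ha hb hab => ?_⟩
  simp only [smul_eq_mul, Finset.mul_sum, ← Finset.sum_add_distrib]
  exact Finset.sum_le_sum fun i hi => (hf i hi).2 hx hy ha hb hab

theorem ConcaveOn.fun_finset_inf' {E ι : Type*} [AddCommGroup E] [Module ℝ E] {s : Set E}
    {t : Finset ι} (ht : t.Nonempty) {f : ι → E → ℝ} (hf : ∀ i ∈ t, ConcaveOn ℝ s (f i)) :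
    ConcaveOn ℝ s (fun x => t.inf' ht (fun i => f i x)) := by
  refine ⟨(hf _ ht.choose_spec).1, fun x hx y hy a b ha hb hab => ?_⟩
  refine Finset.le_inf' ht _ fun i hi => le_trans ?_ ((hf i hi).2 hx hy ha hb hab)
  exact add_le_add (mul_le_mul_of_nonneg_left (Finset.inf'_le _ hi) ha)
    (mul_le_mul_of_nonneg_left (Finset.inf'_le _ hi) hb)

/-- Induction step of Theorem 2: the Bellman (dynamic programming) operator of the
augmented-belief ρ-POMDP reformulation of an ISC-POMDP preserves concavity of
value functions over the belief simplex. -/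
theorem bellman_operator_preserves_concavity
    (𝒮 𝒴 𝒰 : Type*) [Fintype 𝒮] [Fintype 𝒴] [Fintype 𝒰] [Nonempty 𝒰]
    (γ : ℝ) (hγ : 0 ≤ γ)
    (ρ : (𝒮 → ℝ) → 𝒰 → ℝ)
    (hρ : ∀ u : 𝒰, ConcaveOn ℝ (stdSimplex ℝ 𝒮) (fun ξ => ρ ξ u))
    (M : 𝒰 → 𝒴 → Matrix 𝒮 𝒮 ℝ)
    (hnn : ∀ (u : 𝒰) (y : 𝒴) (s' s : 𝒮), 0 ≤ M u y s' s)
    (hpos : ∀ (u : 𝒰) (y : 𝒴), ∀ ξ ∈ stdSimplex ℝ 𝒮,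
      0 < ∑ s' : 𝒮, ∑ s : 𝒮, M u y s' s * ξ s)
    (hsum : ∀ (u : 𝒰) (s : 𝒮), ∑ y : 𝒴, ∑ s' : 𝒮, M u y s' s = 1)
    (V : (𝒮 → ℝ) → ℝ) (hV : ConcaveOn ℝ (stdSimplex ℝ 𝒮) V) :
    ConcaveOn ℝ (stdSimplex ℝ 𝒮)
      (fun ξ => Finset.univ.inf' Finset.univ_nonempty
        (fun u : 𝒰 => ρ ξ u + γ * ∑ y : 𝒴,
          (∑ s' : 𝒮, ∑ s : 𝒮, M u y s' s * ξ s)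
            * V (fun s' => (∑ s : 𝒮, M u y s' s * ξ s)
                / ∑ stil : 𝒮, ∑ s : 𝒮, M u y stil s * ξ s))) := by
  refine ConcaveOn.fun_finset_inf' Finset.univ_nonempty fun u _ => (hρ u).add ?_
  refine ConcaveOn.smul hγ (ConcaveOn.fun_sum (convex_stdSimplex ℝ 𝒮) _ fun y _ => ?_)
  exact (hV.sum_mul_comp_div_sum.comp_linearMap (M u y).mulVecLin).subset
    (fun ξ hξ => ⟨fun s' => Finset.sum_nonneg fun s _ => mul_nonneg (hnn u y s' s) (hξ.1 s),
      hpos u y ξ hξ⟩) (convex_stdSimplex ℝ 𝒮)
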